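/- arXiv:1904.03465 — 5 statements merged into one kernel-verified Lean document; each statement's English description precedes it below -/
import Mathlib

section
/- The k-subalgebra A of the product ring k[x₁,y₁,z₁] × k[x₂,y₂,z₂] generated by the set (I₁ × {0}) ∪ ({0} × I₂) is not finitely generated as a k-algebra. -/
open MvPolynomial

/-- Dual numbers over `k[X]` with constant first part and second part in `M`. -/
def kollarSub (k : Type*) [Field k] (M : Submodule k (Polynomial k)) :
    Subalgebra k (DualNumber (Polynomial k)) where
  carrier := {a | (∃ c : k, a.fst = Polynomial.C c) ∧ a.snd ∈ M}
  mul_mem' := by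
    rintro a b ⟨⟨c, hc⟩, ha⟩ ⟨⟨d, hd⟩, hb⟩
    refine ⟨⟨c * d, by simp [hc, hd]⟩, ?_⟩
    rw [TrivSqZeroExt.snd_mul, hc, hd]
    refine M.add_mem ?_ ?_
    · rw [smul_eq_mul, ← Polynomial.smul_eq_C_mul]
      exact M.smul_mem _ hb
    · rw [op_smul_eq_smul, smul_eq_mul, ← Polynomial.smul_eq_C_mul]
      exact M.smul_mem _ ha
  add_mem' := by
    rintro a b ⟨⟨c, hc⟩, ha⟩ ⟨⟨d, hd⟩, hb⟩
    exact ⟨⟨c + d, by simp [hc, hd]⟩, M.add_mem ha hb⟩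
  algebraMap_mem' := by
    intro r
    refine ⟨⟨r, ?_⟩, ?_⟩
    · simp [TrivSqZeroExt.algebraMap_eq_inl']
    · simp [TrivSqZeroExt.algebraMap_eq_inl']

/-- Evaluation `x ↦ X, y ↦ ε, z ↦ 0` on the first factor. -/
noncomputable def kollarHom (k : Type*) [Field k] :
    MvPolynomial (Fin 3) k × MvPolynomial (Fin 3) k →ₐ[k] DualNumber (Polynomial k) :=
  (aeval ![TrivSqZeroExt.inl Polynomial.X, DualNumber.eps, 0]).comp (AlgHom.fst k _ _)

/-- Kollár's example: the `k`-subalgebra of `k[x₁,y₁,z₁] × k[x₂,y₂,z₂]` generated by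
`(I₁ × {0}) ∪ ({0} × I₂)`, with `I₁ = ⟨y₁,z₁⟩` and `I₂ = ⟨y₂,z₂⟩`, is not finitely
generated as a `k`-algebra. (Variables are indexed so that `X 0 = x`, `X 1 = y`, `X 2 = z`.) -/
theorem subalgebra_generated_by_ideals_not_fg (k : Type*) [Field k] :
    ¬ (Algebra.adjoin k
        ({p : MvPolynomial (Fin 3) k × MvPolynomial (Fin 3) k |
            p.1 ∈ Ideal.span ({X 1, X 2} : Set (MvPolynomial (Fin 3) k)) ∧ p.2 = 0} ∪
         {p : MvPolynomial (Fin 3) k × MvPolynomial (Fin 3) k |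
            p.1 = 0 ∧ p.2 ∈ Ideal.span ({X 1, X 2} : Set (MvPolynomial (Fin 3) k))})).FG := by
  rintro ⟨s, hs⟩
  have h1 : Algebra.adjoin k (s : Set (MvPolynomial (Fin 3) k × MvPolynomial (Fin 3) k)) ≤
      (kollarSub k ⊤).comap (kollarHom k) := by
    rw [hs]
    refine Algebra.adjoin_le ?_
    rintro ⟨p, q⟩ (⟨hp, -⟩ | ⟨hp, -⟩)
    · obtain ⟨a, b, hab⟩ := Ideal.mem_span_pair.1 hp
      refine ⟨⟨0, ?_⟩, trivial⟩
      simp only at hab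
      simp [kollarHom, ← hab]
    · refine ⟨⟨0, ?_⟩, trivial⟩
      simp only at hp
      simp [kollarHom, hp]
  set N := s.sup (fun g => (kollarHom k g).snd.natDegree) with hN
  have h2 : Algebra.adjoin k (s : Set (MvPolynomial (Fin 3) k × MvPolynomial (Fin 3) k)) ≤
      (kollarSub k (Polynomial.degreeLE k N)).comap (kollarHom k) := by
    refine Algebra.adjoin_le fun g hg => ⟨(h1 (Algebra.subset_adjoin hg)).1, ?_⟩
    rw [Polynomial.mem_degreeLE]
    refine Polynomial.degree_le_of_natDegree_le ?_
    exact Finset.le_sup (f := fun g => (kollarHom k g).snd.natDegree) hg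
  have h3 : ((X 0 ^ (N + 1) * X 1, 0) : MvPolynomial (Fin 3) k × MvPolynomial (Fin 3) k) ∈
      Algebra.adjoin k (s : Set (MvPolynomial (Fin 3) k × MvPolynomial (Fin 3) k)) := by
    rw [hs]
    refine Algebra.subset_adjoin (Or.inl ⟨?_, rfl⟩)
    exact Ideal.mul_mem_left _ _ (Ideal.subset_span (by simp))
  have h4 := (h2 h3).2
  rw [Polynomial.mem_degreeLE] at h4
  have h5 : (kollarHom k (X 0 ^ (N + 1) * X 1, 0)).snd = Polynomial.X ^ (N + 1) := by
    simp [kollarHom, ← TrivSqZeroExt.inl_pow]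
  erw [h5] at h4
  rw [Polynomial.degree_X_pow] at h4
  have : N + 1 ≤ N := by exact_mod_cast h4
  omega
end

section
/- The k-subalgebra A of the product ring k[x₁,y₁,z₁] × k[x₂,y₂,z₂] generated by the set (I₁ × {0}) ∪ ({0} × I₂) is not a Noetherian ring. -/
open MvPolynomial

noncomputable def kolPsi (k : Type*) [Field k] :
    MvPolynomial (Fin 3) k →ₐ[k] DualNumber (Polynomial k) :=
  aeval ![TrivSqZeroExt.inl Polynomial.X, DualNumber.eps, 0]

noncomputable def kolFst (k : Type*) [Field k] :
    MvPolynomial (Fin 3) k →ₐ[k] Polynomial k :=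
  (TrivSqZeroExt.fstHom k (Polynomial k) (Polynomial k)).comp (kolPsi k)

lemma kolFst_ideal (k : Type*) [Field k] (p : MvPolynomial (Fin 3) k)
    (hp : p ∈ Ideal.span ({X 1, X 2} : Set (MvPolynomial (Fin 3) k))) : kolFst k p = 0 := by
  have : Ideal.span ({X 1, X 2} : Set (MvPolynomial (Fin 3) k)) ≤ RingHom.ker (kolFst k) := by
    rw [Ideal.span_le]
    rintro q (rfl | rfl) <;> simp [RingHom.mem_ker, kolFst, kolPsi]
  exact this hp

lemma kolPsi_xy (k : Type*) [Field k] (n : ℕ) :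
    kolPsi k (X 0 ^ n * X 1) = TrivSqZeroExt.inr (Polynomial.X ^ n) := by
  have h0 : kolPsi k (X 0) = TrivSqZeroExt.inl Polynomial.X := by simp [kolPsi]
  have h1 : kolPsi k (X 1) = TrivSqZeroExt.inr 1 := by
    simp only [kolPsi, aeval_X]
    rfl
  rw [map_mul, map_pow, h0, h1, TrivSqZeroExt.inl_pow, TrivSqZeroExt.inl_mul_inr, smul_eq_mul,
    mul_one]

lemma kol_aux (k : Type*) [Field k]
    (A : Subalgebra k (MvPolynomial (Fin 3) k × MvPolynomial (Fin 3) k))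
    (h1 : ∀ a ∈ A, ∃ c : k, kolFst k a.1 = Polynomial.C c)
    (h2 : ∀ n : ℕ, ((X 0 ^ n * X 1, 0) : MvPolynomial (Fin 3) k × MvPolynomial (Fin 3) k) ∈ A) :
    ¬ IsNoetherianRing A := by
  intro hN
  let N : ℕ → Submodule A A := fun n =>
    { carrier := {a | kolFst k a.1.1 = 0 ∧ (kolPsi k a.1.1).snd ∈ Polynomial.degreeLT k n}
      zero_mem' := by simp
      add_mem' := by
        rintro a b ⟨ha, ha'⟩ ⟨hb, hb'⟩
        refine ⟨by simp [ha, hb], ?_⟩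
        simpa using add_mem ha' hb'
      smul_mem' := by
        rintro c a ⟨ha, ha'⟩
        refine ⟨by simp [ha], ?_⟩
        obtain ⟨r, hr⟩ := h1 c.1 c.2
        have ha2 : (kolPsi k a.1.1).fst = 0 := ha
        have hr2 : (kolPsi k c.1.1).fst = Polynomial.C r := hr
        have := Submodule.smul_mem _ r ha'
        simpa [ha2, hr2, Polynomial.smul_eq_C_mul] using this }
  have hmono : Monotone N := by
    rintro m n hmn a ⟨ha, ha'⟩
    exact ⟨ha, Polynomial.degreeLT_mono hmn ha'⟩
  obtain ⟨n, hn⟩ := monotone_stabilizes_iff_noetherian.mpr hN ⟨N, hmono⟩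
  have h := hn (n + 1) (Nat.le_succ n)
  have hm : (⟨_, h2 n⟩ : A) ∈ N (n + 1) := by
    refine ⟨?_, ?_⟩
    · change (kolPsi k (X 0 ^ n * X 1)).fst = 0
      simp only [kolPsi_xy, TrivSqZeroExt.fst_inr]
    · simp only [kolPsi_xy, TrivSqZeroExt.snd_inr, Polynomial.mem_degreeLT, Polynomial.degree_X_pow]
      exact_mod_cast Nat.lt_succ_self n
  have h' : N n = N (n + 1) := h
  rw [← h'] at hm
  have := hm.2
  simp only [kolPsi_xy, TrivSqZeroExt.snd_inr, Polynomial.mem_degreeLT, Polynomial.degree_X_pow,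
    lt_self_iff_false] at this

/-- Kollár's example: the `k`-subalgebra of `k[x₁,y₁,z₁] × k[x₂,y₂,z₂]` generated by
`(I₁ × {0}) ∪ ({0} × I₂)`, with `I₁ = ⟨y₁,z₁⟩` and `I₂ = ⟨y₂,z₂⟩`, is not a Noetherian ring. -/
theorem subalgebra_generated_by_ideals_not_noetherian (k : Type*) [Field k] :
    ¬ IsNoetherianRing
      (Algebra.adjoin k
        ({p : MvPolynomial (Fin 3) k × MvPolynomial (Fin 3) k |
            p.1 ∈ Ideal.span ({X 1, X 2} : Set (MvPolynomial (Fin 3) k)) ∧ p.2 = 0} ∪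
         {p : MvPolynomial (Fin 3) k × MvPolynomial (Fin 3) k |
            p.1 = 0 ∧ p.2 ∈ Ideal.span ({X 1, X 2} : Set (MvPolynomial (Fin 3) k))})) := by
  refine kol_aux k _ ?_ ?_
  · intro a ha
    have hle := Algebra.adjoin_le (S := (⊥ : Subalgebra k (Polynomial k)).comap
      ((kolFst k).comp (AlgHom.fst k (MvPolynomial (Fin 3) k) (MvPolynomial (Fin 3) k)))) ?_ ha
    · obtain ⟨c, hc⟩ := Algebra.mem_bot.mp hle
      exact ⟨c, hc.symm⟩
    · rintro p (⟨hp, -⟩ | ⟨hp, -⟩)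
      · have := kolFst_ideal k _ hp
        simp [this]
      · simp [hp]
  · intro n
    refine Algebra.subset_adjoin (Or.inl ⟨?_, rfl⟩)
    exact Ideal.mul_mem_left _ _ (Ideal.subset_span (by simp))
end

section
/- A pair (f,g) belongs to the subalgebra A if and only if there exists a scalar c ∈ k such that f − c ∈ I₁ and g − c ∈ I₂ (where c is identified with the corresponding constant polynomial in each factor). -/
open MvPolynomial

/-- A pair `(f, g)` lies in the `k`-subalgebra of `k[x₁,y₁,z₁] × k[x₂,y₂,z₂]` generated by
`(I₁ × {0}) ∪ ({0} × I₂)` (with `I₁ = ⟨y₁,z₁⟩`, `I₂ = ⟨y₂,z₂⟩`) if and only if there is a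
scalar `c ∈ k` with `f - c ∈ I₁` and `g - c ∈ I₂`. -/
theorem mem_subalgebra_iff_exists_const (k : Type*) [Field k]
    (f g : MvPolynomial (Fin 3) k) :
    (f, g) ∈ Algebra.adjoin k
        ({p : MvPolynomial (Fin 3) k × MvPolynomial (Fin 3) k |
            p.1 ∈ Ideal.span ({X 1, X 2} : Set (MvPolynomial (Fin 3) k)) ∧ p.2 = 0} ∪
         {p : MvPolynomial (Fin 3) k × MvPolynomial (Fin 3) k |
            p.1 = 0 ∧ p.2 ∈ Ideal.span ({X 1, X 2} : Set (MvPolynomial (Fin 3) k))}) ↔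
      ∃ c : k, f - C c ∈ Ideal.span ({X 1, X 2} : Set (MvPolynomial (Fin 3) k)) ∧
        g - C c ∈ Ideal.span ({X 1, X 2} : Set (MvPolynomial (Fin 3) k)) := by
  generalize Ideal.span ({X 1, X 2} : Set (MvPolynomial (Fin 3) k)) = I
  have key : ∀ (a b : MvPolynomial (Fin 3) k) (c d : k), a - C c ∈ I → b - C d ∈ I →
      a * b - C (c * d) ∈ I := by
    intro a b c d h1 h2
    have : a * b - C (c * d) = b * (a - C c) + C c * (b - C d) := by
      rw [C_mul]; ring
    rw [this]
    exact I.add_mem (I.mul_mem_left _ h1) (I.mul_mem_left _ h2)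
  have key2 : ∀ (a b : MvPolynomial (Fin 3) k) (c d : k), a - C c ∈ I → b - C d ∈ I →
      a + b - C (c + d) ∈ I := by
    intro a b c d h1 h2
    have : a + b - C (c + d) = (a - C c) + (b - C d) := by
      rw [C_add]; ring
    rw [this]
    exact I.add_mem h1 h2
  constructor
  · intro h
    suffices H : ∀ p : MvPolynomial (Fin 3) k × MvPolynomial (Fin 3) k,
        p ∈ Algebra.adjoin k
          ({p : MvPolynomial (Fin 3) k × MvPolynomial (Fin 3) k | p.1 ∈ I ∧ p.2 = 0} ∪
           {p : MvPolynomial (Fin 3) k × MvPolynomial (Fin 3) k | p.1 = 0 ∧ p.2 ∈ I}) →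
        ∃ c : k, p.1 - C c ∈ I ∧ p.2 - C c ∈ I from H _ h
    intro p hp
    induction hp using Algebra.adjoin_induction with
    | mem x hx =>
      refine ⟨0, ?_⟩
      rcases hx with ⟨h1, h2⟩ | ⟨h1, h2⟩
      · simp [h1, h2]
      · simp [h1, h2]
    | algebraMap r =>
      refine ⟨r, ?_⟩
      simp [Prod.algebraMap_apply, MvPolynomial.algebraMap_eq]
    | add x y _ _ hx hy =>
      obtain ⟨c, h1, h2⟩ := hx
      obtain ⟨d, h3, h4⟩ := hy
      exact ⟨c + d, key2 _ _ _ _ h1 h3, key2 _ _ _ _ h2 h4⟩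
    | mul x y _ _ hx hy =>
      obtain ⟨c, h1, h2⟩ := hx
      obtain ⟨d, h3, h4⟩ := hy
      exact ⟨c * d, key _ _ _ _ h1 h3, key _ _ _ _ h2 h4⟩
  · rintro ⟨c, h1, h2⟩
    have e : (f, g) = algebraMap k (MvPolynomial (Fin 3) k × MvPolynomial (Fin 3) k) c
        + (f - C c, 0) + (0, g - C c) := by
      ext1 <;> simp [Prod.algebraMap_apply, MvPolynomial.algebraMap_eq]
    rw [e]
    refine add_mem (add_mem (Subalgebra.algebraMap_mem _ c) ?_) ?_
    · exact Algebra.subset_adjoin (Or.inl ⟨h1, rfl⟩)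
    · exact Algebra.subset_adjoin (Or.inr ⟨rfl, h2⟩)
end

section
/- For every pair of integers m, n, the points (0,0,m) and (0,0,n) of k³ are related by the equivalence relation generated by r; in particular all points (0,0,n) with n ∈ ℤ lie in a single equivalence class. -/
/-- In the gluing example with `X̃ = 𝔸³`, `Γ = {xy = 0}` and involution
`τ(y₁,z₁) = (x₂, z₂+1)`, the induced relation `r` on `k³` relates `(0,a,b)` to `(a,0,b+1)`.
For all integers `m, n`, the points `(0,0,m)` and `(0,0,n)` are identified by the equivalence
relation generated by `r`: all the points `(0,0,n)`, `n ∈ ℤ`, lie in a single equivalence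
class. -/
theorem glued_points_all_equivalent (k : Type*) [Field k] [CharZero k]
    (r : k × k × k → k × k × k → Prop)
    (hr : ∀ p q, r p q ↔ ∃ a b : k, p = (0, a, b) ∧ q = (a, 0, b + 1)) :
    ∀ m n : ℤ, Relation.EqvGen r ((0 : k), (0 : k), (m : k)) ((0 : k), (0 : k), (n : k)) := by
  have step : ∀ b : k, Relation.EqvGen r ((0 : k), (0 : k), b) ((0 : k), (0 : k), b + 1) :=
    fun b => Relation.EqvGen.rel _ _ ((hr _ _).2 ⟨0, b, rfl, rfl⟩)
  have key : ∀ n : ℤ, Relation.EqvGen r ((0 : k), (0 : k), (0 : k)) ((0 : k), (0 : k), (n : k)) := by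
    intro n
    induction n using Int.induction_on with
    | zero => simpa using Relation.EqvGen.refl _
    | succ i ih =>
      have h := ih.trans _ _ _ (step _)
      simpa using h
    | pred i ih =>
      have h := step (((-(i : ℤ) - 1 : ℤ)) : k)
      have e : (((-(i : ℤ) - 1 : ℤ)) : k) + 1 = ((-(i : ℤ) : ℤ) : k) := by
        push_cast; ring
      rw [e] at h
      exact ih.trans _ _ _ (h.symm _ _)
  intro m n
  exact ((key m).symm _ _).trans _ _ _ (key n)
end

section
/- The equivalence class of the point (0,0,0) of k³ under the equivalence relation generated by r is an infinite set. -/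
/-- In the gluing example with `X̃ = 𝔸³`, `Γ = {xy = 0}` and involution
`τ(y₁,z₁) = (x₂, z₂+1)`, the induced relation `r` on `k³` relates `(0,a,b)` to `(a,0,b+1)`.
The equivalence class of `(0,0,0)` under the equivalence relation generated by `r` is
infinite. -/
theorem glued_equivalence_class_infinite (k : Type*) [Field k] [CharZero k]
    (r : k × k × k → k × k × k → Prop)
    (hr : ∀ p q, r p q ↔ ∃ a b : k, p = (0, a, b) ∧ q = (a, 0, b + 1)) :
    {p : k × k × k | Relation.EqvGen r p ((0 : k), (0 : k), (0 : k))}.Infinite := by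
  have key : ∀ n : ℕ, Relation.EqvGen r ((0 : k), (0 : k), (n : k)) (0, 0, 0) := by
    intro n
    induction n with
    | zero => simpa using Relation.EqvGen.refl ((0 : k), (0 : k), (0 : k))
    | succ n ih =>
      refine Relation.EqvGen.trans _ _ _ (Relation.EqvGen.symm _ _ (Relation.EqvGen.rel _ _ ?_)) ih
      exact (hr _ _).2 ⟨0, n, rfl, by push_cast; rfl⟩
  refine Set.infinite_of_injective_forall_mem (f := fun n : ℕ => ((0 : k), (0 : k), (n : k))) ?_ key
  intro m n h
  simpa using h
end
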